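/- For every integer n ≥ 6 there exist n pairwise distinct subsets F₁, …, F_n of ℝ² such that: (i) for every nonempty subset I ⊆ {1,…,n}, the intersection ⋂_{i∈I} F_i is either empty or path-connected; (ii) for every subset I ⊆ {1,…,n} with |I| ≥ 4, ⋂_{i∈I} F_i = ∅; and (iii) the number of 3-element subsets I ⊆ {1,…,n} with ⋂_{i∈I} F_i ≠ ∅ is at least C(n−1, 2) + (n² − 6n + 3)/3. -/

import Mathlib

section

open Finset

/-- Affine functionals `f i` on `E`, thought of as the lines `f i = 0` of a simple arrangement,
with a set `tri` of triangular cells, each cell being given by its three bounding lines and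
equipped with barycentric coordinates. -/
structure TriangleSystem (ι E : Type*) [NormedAddCommGroup E] [NormedSpace ℝ E] where
  /-- the functionals defining the lines -/
  f : ι → E →ᵃ[ℝ] ℝ
  /-- the triangular cells -/
  tri : Finset (Finset ι)
  /-- barycentric coordinates on a cell -/
  lam : Finset ι → ι → E →ᵃ[ℝ] ℝ
  /-- the vertex of a cell opposite to a side -/
  vtx : Finset ι → ι → E
  /-- the barycentre of a cell -/
  cen : Finset ι → E
  exists_common : ∀ i j, i ≠ j → ∃ q, f i q = 0 ∧ f j q = 0
  ne_zero_of_common : ∀ i j k w, i ≠ j → i ≠ k → j ≠ k → f i w = 0 → f j w = 0 → f k w ≠ 0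
  eq_of_eq : ∀ i j w w', i ≠ j → f i w = f i w' → f j w = f j w' → w = w'
  card_tri : ∀ T ∈ tri, #T = 3
  lam_eq : ∀ T ∈ tri, ∀ i ∈ T, ∃ c : ℝ, c ≠ 0 ∧ ∀ w, lam T i w = c * f i w
  lam_vtx_self : ∀ T ∈ tri, ∀ i ∈ T, lam T i (vtx T i) = 1
  lam_vtx : ∀ T ∈ tri, ∀ i ∈ T, ∀ j ∈ T, j ≠ i → lam T j (vtx T i) = 0
  lam_cen : ∀ T ∈ tri, ∀ i ∈ T, lam T i (cen T) = 1 / 3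
  sum_lam : ∀ T ∈ tri, ∀ w, ∑ i ∈ T, lam T i w = 1
  sep : ∀ T ∈ tri, ∀ l ∉ T, ∀ w w', (∀ i ∈ T, 0 ≤ lam T i w) → (∀ i ∈ T, 0 ≤ lam T i w') →
    0 < f l w * f l w'

namespace TriangleSystem

variable {ι E : Type*} [NormedAddCommGroup E] [NormedSpace ℝ E] (S : TriangleSystem ι E)

/-- The part of the cell `T` where the coordinate `i` is minimal. -/
def part (T : Finset ι) (i : ι) : Set E :=
  {w | 0 ≤ S.lam T i w ∧ ∀ j ∈ T, S.lam T i w ≤ S.lam T j w}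

/-- The line `i` together with the adjacent parts of all cells it bounds. -/
def thick (i : ι) : Set E :=
  {w | S.f i w = 0 ∨ ∃ T ∈ S.tri, i ∈ T ∧ w ∈ S.part T i}

/-- The barycentres of all cells. -/
def centers : Set E :=
  {w | ∃ T ∈ S.tri, ∀ i ∈ T, S.lam T i w = 1 / 3}

/-- The sets `thick i`, and the complement of the set of barycentres. -/
def family : Option ι → Set E
  | none => S.centersᶜ
  | some i => S.thick i

variable {S}

lemma lam_eq_zero_iff {T : Finset ι} (hT : T ∈ S.tri) {i : ι} (hi : i ∈ T) {w : E} :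
    S.lam T i w = 0 ↔ S.f i w = 0 := by
  obtain ⟨c, hc, h⟩ := S.lam_eq T hT i hi
  simp [h, hc]

lemma lam_nonneg_vtx {T : Finset ι} (hT : T ∈ S.tri) {i : ι} (hi : i ∈ T) :
    ∀ j ∈ T, 0 ≤ S.lam T j (S.vtx T i) := by
  intro j hj
  by_cases h : j = i
  · subst h
    rw [S.lam_vtx_self T hT j hj]
    norm_num
  · rw [S.lam_vtx T hT i hi j hj h]

lemma part_nonneg {T : Finset ι} {i : ι} {w : E} (h : w ∈ S.part T i) :
    ∀ j ∈ T, 0 ≤ S.lam T j w := fun j hj => h.1.trans (h.2 j hj)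

lemma f_ne_zero_of_notMem {T : Finset ι} (hT : T ∈ S.tri) {l : ι} (hl : l ∉ T) {w : E}
    (hw : ∀ i ∈ T, 0 ≤ S.lam T i w) : S.f l w ≠ 0 := by
  intro h
  have := S.sep T hT l hl w w hw hw
  simp [h] at this

/-- Distinct cells have no common interior point. -/
lemma tri_eq_of_pos {T T' : Finset ι} (hT : T ∈ S.tri) (hT' : T' ∈ S.tri) {w : E}
    (hw : ∀ i ∈ T, 0 < S.lam T i w) (hw' : ∀ i ∈ T', 0 ≤ S.lam T' i w) : T = T' := by
  by_contra hne
  obtain ⟨l, hl', hl⟩ : ∃ l ∈ T', l ∉ T := by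
    by_contra! h
    exact hne (Finset.eq_of_subset_of_card_le h
      (by rw [S.card_tri T hT, S.card_tri T' hT'])).symm
  obtain ⟨j, hj, hjl⟩ : ∃ j ∈ T', j ≠ l :=
    Finset.exists_mem_ne (by rw [S.card_tri T' hT']; norm_num) l
  have hv := lam_nonneg_vtx hT' hj
  have hlv : S.f l (S.vtx T' j) = 0 :=
    (lam_eq_zero_iff hT' hl').1 (S.lam_vtx T' hT' j hj l hl' hjl.symm)
  refine f_ne_zero_of_notMem hT hl (w := S.vtx T' j) ?_ hlv
  intro i hi
  obtain ⟨c, hc, h⟩ := S.lam_eq T hT i hi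
  have hwi := hw i hi
  have key : 0 ≤ S.f i w * S.f i (S.vtx T' j) := by
    by_cases hi' : i ∈ T'
    · obtain ⟨c', hc', h'⟩ := S.lam_eq T' hT' i hi'
      have h1 := mul_nonneg (hw' i hi') (hv i hi')
      rw [h', h'] at h1
      have h2 : 0 < c' ^ 2 := by positivity
      exact nonneg_of_mul_nonneg_right (by linarith : 0 ≤ c' ^ 2 * _) h2
    · exact (S.sep T' hT' i hi' _ _ hw' hv).le
  have h3 : 0 ≤ S.lam T i w * S.lam T i (S.vtx T' j) := by
    rw [h, h, show c * S.f i w * (c * S.f i (S.vtx T' j))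
      = c ^ 2 * (S.f i w * S.f i (S.vtx T' j)) by ring]
    positivity
  exact nonneg_of_mul_nonneg_right h3 hwi

lemma part_pos {T : Finset ι} (hT : T ∈ S.tri) {i : ι} (hi : i ∈ T) {w : E}
    (h : w ∈ S.part T i) (hf : S.f i w ≠ 0) : ∀ j ∈ T, 0 < S.lam T j w := by
  intro j hj
  have h0 : S.lam T i w ≠ 0 := fun h' => hf ((lam_eq_zero_iff hT hi).1 h')
  exact (lt_of_le_of_ne h.1 h0.symm).trans_le (h.2 j hj)

lemma part_f_eq_zero {T : Finset ι} (hT : T ∈ S.tri) {i j : ι} (hi : i ∈ T) {w : E}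
    (h : w ∈ S.part T i) (hj : S.f j w = 0) : S.f i w = 0 := by
  by_contra hf
  by_cases hjT : j ∈ T
  · exact (part_pos hT hi h hf j hjT).ne' ((lam_eq_zero_iff hT hjT).2 hj)
  · exact f_ne_zero_of_notMem hT hjT (part_nonneg h) hj

lemma mem_thick_iff {J : Finset ι} {w : E} :
    (∀ i ∈ J, w ∈ S.thick i) ↔
      (∀ i ∈ J, S.f i w = 0) ∨ ∃ T ∈ S.tri, J ⊆ T ∧ ∀ i ∈ J, w ∈ S.part T i := by
  constructor
  · intro h
    by_cases hall : ∀ i ∈ J, S.f i w = 0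
    · exact Or.inl hall
    push Not at hall
    obtain ⟨i, hi, hfi⟩ := hall
    obtain ⟨T, hT, hiT, hw⟩ := (h i hi).resolve_left hfi
    have key : ∀ j ∈ J, j ∈ T ∧ w ∈ S.part T j := by
      intro j hj
      rcases h j hj with h0 | ⟨T', hT', hjT', hw'⟩
      · exact absurd (part_f_eq_zero hT hiT hw h0) hfi
      · obtain rfl := tri_eq_of_pos hT hT' (part_pos hT hiT hw hfi) (part_nonneg hw')
        exact ⟨hjT', hw'⟩
    exact Or.inr ⟨T, hT, fun j hj => (key j hj).1, fun j hj => (key j hj).2⟩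
  · rintro (h | ⟨T, hT, hJ, h⟩) i hi
    · exact Or.inl (h i hi)
    · exact Or.inr ⟨T, hT, hJ hi, h i hi⟩

lemma lam_eq_third {T : Finset ι} (hT : T ∈ S.tri) {w : E}
    (h : ∀ i ∈ T, 1 / 3 ≤ S.lam T i w) : ∀ i ∈ T, S.lam T i w = 1 / 3 := by
  have hs : ∑ i ∈ T, (1 / 3 : ℝ) = ∑ i ∈ T, S.lam T i w := by
    rw [S.sum_lam T hT, Finset.sum_const, S.card_tri T hT]
    norm_num
  intro i hi
  exact ((Finset.sum_eq_sum_iff_of_le h).1 hs i hi).symm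

/-- A point of at least three of the thick lines is the barycentre of a cell. -/
lemma eq_of_three_le {J : Finset ι} (hJ : 3 ≤ #J) {w : E} (h : ∀ i ∈ J, w ∈ S.thick i) :
    J ∈ S.tri ∧ ∀ i ∈ J, S.lam J i w = 1 / 3 := by
  rcases mem_thick_iff.1 h with h0 | ⟨T, hT, hJT, hw⟩
  · obtain ⟨i, hi, j, hj, k, hk, hij, hik, hjk⟩ := Finset.two_lt_card.1 hJ
    exact absurd (h0 k hk) (S.ne_zero_of_common i j k w hij hik hjk (h0 i hi) (h0 j hj))
  · obtain rfl : J = T := Finset.eq_of_subset_of_card_le hJT (by rw [S.card_tri T hT]; exact hJ)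
    refine ⟨hT, lam_eq_third hT fun i hi => ?_⟩
    have h1 : ∑ j ∈ J, S.lam J j w ≤ ∑ j ∈ J, S.lam J i w :=
      Finset.sum_le_sum fun j hj => (hw j hj).2 i hi
    rw [S.sum_lam J hT, Finset.sum_const, S.card_tri J hT, nsmul_eq_mul] at h1
    push_cast at h1
    linarith

lemma card_le_three {J : Finset ι} {w : E} (h : ∀ i ∈ J, w ∈ S.thick i) : #J ≤ 3 := by
  by_contra hJ
  have := S.card_tri J (eq_of_three_le (by omega) h).1
  omega

lemma f_ne_zero_of_mem_centers {w : E} (h : w ∈ S.centers) (i : ι) : S.f i w ≠ 0 := by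
  obtain ⟨T, hT, h⟩ := h
  by_cases hi : i ∈ T
  · rw [Ne, ← lam_eq_zero_iff hT hi, h i hi]
    norm_num
  · exact f_ne_zero_of_notMem hT hi fun j hj => by rw [h j hj]; norm_num

lemma part_notMem_centers_iff {T : Finset ι} (hT : T ∈ S.tri) {i : ι} (hi : i ∈ T) {w : E}
    (h : w ∈ S.part T i) : w ∉ S.centers ↔ S.lam T i w < 1 / 3 := by
  constructor
  · intro hw
    by_contra! hle
    exact hw ⟨T, hT, lam_eq_third hT fun j hj => hle.trans (h.2 j hj)⟩
  · rintro hlt ⟨T', hT', hw'⟩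
    obtain rfl : T' = T :=
      tri_eq_of_pos hT' hT (fun j hj => by rw [hw' j hj]; norm_num) (part_nonneg h)
    rw [hw' i hi] at hlt
    exact lt_irrefl _ hlt

lemma finite_centers : S.centers.Finite := by
  have : S.centers = ⋃ T ∈ S.tri, {w | ∀ i ∈ T, S.lam T i w = 1 / 3} := by
    ext w
    simp [centers]
  rw [this]
  refine S.tri.finite_toSet.biUnion fun T hT => Set.Subsingleton.finite ?_
  intro w hw w' hw'
  obtain ⟨i, hi, j, hj, hij⟩ := Finset.one_lt_card.1
    (show 1 < #T by rw [S.card_tri T hT]; norm_num)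
  have key : ∀ i ∈ T, S.f i w = S.f i w' := by
    intro i hi
    obtain ⟨c, hc, h⟩ := S.lam_eq T hT i hi
    refine mul_left_cancel₀ hc ?_
    rw [← h, ← h, hw i hi, hw' i hi]
  exact S.eq_of_eq i j w w' hij (key i hi) (key j hj)

lemma isPathConnected_of_convex_cover {A B : Set E} (hB : Convex ℝ B) (hBne : B.Nonempty)
    (hBA : B ⊆ A) (h : ∀ w ∈ A, ∃ C ⊆ A, Convex ℝ C ∧ w ∈ C ∧ (C ∩ B).Nonempty) :
    IsPathConnected A := by
  obtain ⟨b, hb⟩ := hBne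
  refine ⟨b, hBA hb, fun {w} hw => ?_⟩
  obtain ⟨C, hCA, hC, hwC, x, hxC, hxB⟩ := h w hw
  exact ((JoinedIn.of_segment_subset (hB.segment_subset hb hxB)).mono hBA).trans
    ((JoinedIn.of_segment_subset (hC.segment_subset hxC hwC)).mono hCA)

lemma convex_part (T : Finset ι) (i : ι) : Convex ℝ (S.part T i) := by
  intro x hx y hy a b ha hb hab
  refine ⟨?_, fun j hj => ?_⟩
  · rw [Convex.combo_affine_apply hab]
    exact add_nonneg (mul_nonneg ha hx.1) (mul_nonneg hb hy.1)
  · rw [Convex.combo_affine_apply hab, Convex.combo_affine_apply hab]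
    exact add_le_add (mul_le_mul_of_nonneg_left (hx.2 j hj) ha)
      (mul_le_mul_of_nonneg_left (hy.2 j hj) hb)

lemma exists_common_of_card_le_two [Nontrivial ι] {J : Finset ι} (hJ : #J ≤ 2) :
    ∃ q, ∀ i ∈ J, S.f i q = 0 := by
  classical
  rcases Nat.lt_or_ge #J 2 with h | h
  · rcases Finset.card_le_one_iff_subset_singleton.1 (Nat.lt_succ_iff.1 h) with ⟨i, hi⟩
    obtain ⟨j, hj⟩ := exists_ne i
    obtain ⟨q, hq, -⟩ := S.exists_common i j hj.symm
    exact ⟨q, fun k hk => by rw [Finset.mem_singleton.1 (hi hk)]; exact hq⟩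
  · obtain ⟨i, j, hij, rfl⟩ := Finset.card_eq_two.1 (le_antisymm hJ h)
    obtain ⟨q, hq, hq'⟩ := S.exists_common i j hij
    exact ⟨q, by simp [hq, hq']⟩

/-- One or two thick lines, with or without the barycentres, have a path-connected
intersection. -/
lemma isPathConnected_of_card_le_two [Nontrivial ι] {J : Finset ι} (hJ : #J ≤ 2)
    (hJne : J.Nonempty) (p : Prop) :
    IsPathConnected {w | (p → w ∉ S.centers) ∧ ∀ i ∈ J, w ∈ S.thick i} := by
  obtain ⟨q, hq⟩ := exists_common_of_card_le_two (S := S) hJ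
  obtain ⟨i₀, hi₀⟩ := hJne
  have hBA : {w | ∀ i ∈ J, S.f i w = 0} ⊆
      {w | (p → w ∉ S.centers) ∧ ∀ i ∈ J, w ∈ S.thick i} := fun w hw =>
    ⟨fun _ h => f_ne_zero_of_mem_centers h i₀ (hw i₀ hi₀), fun i hi => Or.inl (hw i hi)⟩
  refine isPathConnected_of_convex_cover (B := {w | ∀ i ∈ J, S.f i w = 0}) ?_ ⟨q, hq⟩ hBA ?_
  · intro x hx y hy a b ha hb hab i hi
    rw [Convex.combo_affine_apply hab, hx i hi, hy i hi]
    simp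
  · rintro w ⟨hwp, hw⟩
    rcases mem_thick_iff.1 hw with h0 | ⟨T, hT, hJT, hwT⟩
    · exact ⟨{w}, by simpa using ⟨hwp, hw⟩, convex_singleton w, rfl, w, rfl, h0⟩
    obtain ⟨k, hk, hkJ⟩ : ∃ k ∈ T, k ∉ J := by
      by_contra! h
      have := Finset.card_le_card h
      rw [S.card_tri T hT] at this
      omega
    have hv0 : ∀ i ∈ J, S.lam T i (S.vtx T k) = 0 := fun i hi =>
      S.lam_vtx T hT k hk i (hJT hi) (by rintro rfl; exact hkJ hi)
    refine ⟨{x | (∀ i ∈ J, x ∈ S.part T i) ∧ (p → S.lam T i₀ x < 1 / 3)}, ?_, ?_, ?_, ?_⟩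
    · rintro x ⟨hx, hxp⟩
      exact ⟨fun hp => (part_notMem_centers_iff hT (hJT hi₀) (hx i₀ hi₀)).2 (hxp hp),
        mem_thick_iff.2 (Or.inr ⟨T, hT, hJT, hx⟩)⟩
    · intro x hx y hy a b ha hb hab
      refine ⟨fun i hi => convex_part T i (hx.1 i hi) (hy.1 i hi) ha hb hab, fun hp => ?_⟩
      exact (convex_Iio (1 / 3 : ℝ)).affine_preimage (S.lam T i₀) (hx.2 hp) (hy.2 hp) ha hb hab
    · exact ⟨hwT, fun hp => (part_notMem_centers_iff hT (hJT hi₀) (hwT i₀ hi₀)).1 (hwp hp)⟩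
    · refine ⟨S.vtx T k, ⟨fun i hi => ⟨(hv0 i hi).ge, fun j hj => ?_⟩, fun _ => ?_⟩, ?_⟩
      · rw [hv0 i hi]
        exact lam_nonneg_vtx hT hk j hj
      · rw [hv0 i₀ hi₀]
        norm_num
      · exact fun i hi => (lam_eq_zero_iff hT (hJT hi)).1 (hv0 i hi)

lemma iInter_family (I : Finset (Option ι)) :
    (⋂ a ∈ I, S.family a) =
      {w | (none ∈ I → w ∉ S.centers) ∧ ∀ i ∈ I.eraseNone, w ∈ S.thick i} := by
  ext w
  simp only [Set.mem_iInter, Set.mem_ofPred_eq, Finset.mem_eraseNone]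
  constructor
  · exact fun h => ⟨fun hI => h none hI, fun i hi => h (some i) hi⟩
  · rintro ⟨h, h'⟩ (_ | i) hi
    · exact h hi
    · exact h' i hi

lemma card_le_card_eraseNone [DecidableEq ι] (I : Finset (Option ι)) :
    #I ≤ #I.eraseNone + 1 ∧ (none ∉ I → #I = #I.eraseNone) := by
  constructor
  · rw [← Finset.card_map (s := I.eraseNone) Function.Embedding.some,
      Finset.map_some_eraseNone]
    have := Finset.pred_card_le_card_erase (s := I) (a := none)
    omega
  · intro h
    rw [← Finset.card_map (s := I.eraseNone) Function.Embedding.some,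
      Finset.map_some_eraseNone, Finset.erase_eq_of_notMem h]

lemma iInter_family_eq_empty [DecidableEq ι] {I : Finset (Option ι)} (hI : 4 ≤ #I) :
    (⋂ a ∈ I, S.family a) = ∅ := by
  rw [iInter_family, Set.eq_empty_iff_forall_notMem]
  rintro w ⟨hw, hw'⟩
  obtain ⟨h1, h2⟩ := card_le_card_eraseNone I
  have h3 := card_le_three hw'
  by_cases hn : none ∈ I
  · exact hw hn ⟨_, eq_of_three_le (by omega) hw'⟩
  · have := h2 hn
    omega

lemma iInter_family_isPathConnected [DecidableEq ι] [Nontrivial ι]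
    (hE : 1 < Module.rank ℝ E) {I : Finset (Option ι)} (hI : I.Nonempty) :
    (⋂ a ∈ I, S.family a) = ∅ ∨ IsPathConnected (⋂ a ∈ I, S.family a) := by
  rw [iInter_family]
  rcases Finset.eq_empty_or_nonempty I.eraseNone with h0 | hne
  · right
    have hn : none ∈ I := by
      by_contra h
      have := (card_le_card_eraseNone I).2 h
      rw [h0, Finset.card_empty, Finset.card_eq_zero] at this
      simp [this] at hI
    simpa [h0, hn, Set.compl_def] using
      (finite_centers (S := S)).countable.isPathConnected_compl_of_one_lt_rank hE
  rcases Nat.lt_or_ge #I.eraseNone 3 with h | h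
  · exact Or.inr (isPathConnected_of_card_le_two (by omega) hne _)
  · rw [or_iff_not_imp_left, ← Ne, ← Set.nonempty_iff_ne_empty]
    rintro ⟨w, hw⟩
    have : {w | (none ∈ I → w ∉ S.centers) ∧ ∀ i ∈ I.eraseNone, w ∈ S.thick i} = {w} := by
      refine Set.Subsingleton.eq_singleton_of_mem ?_ hw
      intro x hx y hy
      obtain ⟨hT, hx'⟩ := eq_of_three_le h hx.2
      obtain ⟨-, hy'⟩ := eq_of_three_le h hy.2
      obtain ⟨i, hi, j, hj, hij⟩ := Finset.one_lt_card.1 (show 1 < #I.eraseNone by omega)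
      have key : ∀ i ∈ I.eraseNone, S.f i x = S.f i y := by
        intro i hi
        obtain ⟨c, hc, h⟩ := S.lam_eq _ hT i hi
        refine mul_left_cancel₀ hc ?_
        rw [← h, ← h, hx' i hi, hy' i hi]
      exact S.eq_of_eq i j x y hij (key i hi) (key j hj)
    rw [this]
    exact isPathConnected_singleton w

lemma iInter_family_nonempty_of_none [Nontrivial ι] {J : Finset ι} (hJ : #J ≤ 2)
    (hJne : J.Nonempty) : (⋂ a ∈ insertNone J, S.family a).Nonempty := by
  rw [iInter_family]
  simpa using (isPathConnected_of_card_le_two (S := S) hJ hJne True).nonempty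

lemma iInter_family_nonempty_of_tri {T : Finset ι} (hT : T ∈ S.tri) :
    (⋂ a ∈ T.map Function.Embedding.some, S.family a).Nonempty := by
  refine ⟨S.cen T, ?_⟩
  rw [iInter_family]
  refine ⟨by simp, fun i hi => Or.inr ⟨T, hT, ?_⟩⟩
  have hi : i ∈ T := by simpa using hi
  refine ⟨hi, ?_, fun j hj => ?_⟩
  · rw [S.lam_cen T hT i hi]; norm_num
  · rw [S.lam_cen T hT i hi, S.lam_cen T hT j hj]

lemma family_injective [Fintype ι] [DecidableEq ι] (hι : 3 ≤ Fintype.card ι) :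
    Function.Injective S.family := by
  have : Nontrivial ι := Fintype.one_lt_card_iff_nontrivial.1 (by omega)
  have key : ∀ (a : Option ι) (J : Finset ι), a ∉ insertNone J → #J = 2 →
      ∀ b ∈ insertNone J, S.family a ≠ S.family b := by
    intro a J ha hJ b hb hab
    obtain ⟨w, hw⟩ := iInter_family_nonempty_of_none (S := S) hJ.le
      (Finset.card_pos.1 (by omega))
    have h4 : (⋂ c ∈ insert a (insertNone J), S.family c) = ∅ := by
      refine iInter_family_eq_empty ?_
      rw [Finset.card_insert_of_notMem ha, Finset.card_insertNone]
      omega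
    refine Set.notMem_empty w (h4 ▸ ?_)
    simp only [Set.mem_iInter, Finset.mem_insert] at hw ⊢
    rintro c (rfl | hc)
    · rw [hab]
      exact hw b hb
    · exact hw c hc
  have ex : ∀ i j : ι, ∃ k, k ≠ i ∧ k ≠ j := by
    intro i j
    obtain ⟨k, hk⟩ : ∃ k, k ∉ ({i, j} : Finset ι) := by
      by_contra! h
      have h1 := Finset.card_le_card (fun x _ => h x : (univ : Finset ι) ⊆ {i, j})
      have h2 := Finset.card_le_two (a := i) (b := j)
      rw [Finset.card_univ] at h1
      omega
    exact ⟨k, by simpa using hk⟩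
  have h1 : ∀ i : ι, ∀ b : Option ι, b ≠ some i → S.family (some i) ≠ S.family b := by
    rintro i (_ | j) hb
    · obtain ⟨j, hj, -⟩ := ex i i
      obtain ⟨k, hk, hkj⟩ := ex i j
      exact key (some i) {j, k} (by simp [hj.symm, hk.symm]) (Finset.card_pair hkj.symm) _
        (by simp)
    · have hji : j ≠ i := by simpa using hb
      obtain ⟨k, hk, hkj⟩ := ex i j
      exact key (some i) {j, k} (by simp [hji.symm, hk.symm]) (Finset.card_pair hkj.symm) _
        (by simp)
  rintro a b hab
  by_contra hne
  rcases a with _ | i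
  · rcases b with _ | j
    · exact hne rfl
    · exact h1 j none (by simp) hab.symm
  · exact h1 i b (Ne.symm hne) hab

lemma choose_add_card_le [Fintype ι] [DecidableEq ι] [Nontrivial ι] :
    (Fintype.card ι).choose 2 + #S.tri ≤
      {I : Finset (Option ι) | #I = 3 ∧ (⋂ a ∈ I, S.family a).Nonempty}.ncard := by
  have hA : #((powersetCard 2 (univ : Finset ι)).image fun J => insertNone J) =
      (Fintype.card ι).choose 2 := by
    rw [Finset.card_image_of_injective _ insertNone.injective, Finset.card_powersetCard,
      Finset.card_univ]
  have hB : #(S.tri.image fun T => T.map Function.Embedding.some) = #S.tri :=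
    Finset.card_image_of_injective _ (Finset.map_injective _)
  rw [← hA, ← hB, ← Finset.card_union_of_disjoint, ← Set.ncard_coe_finset]
  · refine Set.ncard_le_ncard ?_ (Set.toFinite _)
    intro I hI
    simp only [Finset.coe_union, Finset.coe_image, Set.mem_union, Set.mem_image,
      Finset.mem_coe, Finset.mem_powersetCard] at hI
    rcases hI with ⟨J, ⟨-, hJ⟩, rfl⟩ | ⟨T, hT, rfl⟩
    · exact ⟨by rw [Finset.card_insertNone, hJ],
        iInter_family_nonempty_of_none hJ.le (Finset.card_pos.1 (by omega))⟩
    · exact ⟨by rw [Finset.card_map, S.card_tri T hT], iInter_family_nonempty_of_tri hT⟩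
  · rw [Finset.disjoint_left]
    intro I hI hI'
    obtain ⟨J, -, rfl⟩ := Finset.mem_image.1 hI
    obtain ⟨T, -, h⟩ := Finset.mem_image.1 hI'
    have : (none : Option ι) ∈ T.map Function.Embedding.some := h ▸ by simp
    simp at this

end TriangleSystem
lemma AffineMap.apply_triangle {E : Type*} [NormedAddCommGroup E] [NormedSpace ℝ E]
    (g : E →ᵃ[ℝ] ℝ) (x y z : E) (s t : ℝ) :
    g (x + s • (y - x) + t • (z - x)) = g x + s * (g y - g x) + t * (g z - g x) := by
  have h : ∀ w, g w = g.linear w + g 0 := fun w => congrFun g.decomp w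
  rw [h (x + s • (y - x) + t • (z - x)), h x, h y, h z]
  simp only [map_add, map_sub, map_smul, smul_eq_mul]
  ring

/-- Barycentric coordinates of the triangle formed by three lines in general position. -/
lemma exists_barycentric {ι E : Type*} [NormedAddCommGroup E] [NormedSpace ℝ E]
    (f : ι → E →ᵃ[ℝ] ℝ)
    (h1 : ∀ i j, i ≠ j → ∃ q, f i q = 0 ∧ f j q = 0)
    (h2 : ∀ i j k w, i ≠ j → i ≠ k → j ≠ k → f i w = 0 → f j w = 0 → f k w ≠ 0)
    (h3 : ∀ i j w w', i ≠ j → f i w = f i w' → f j w = f j w' → w = w')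
    (T : Finset ι) (hT : #T = 3) :
    ∃ (lam : ι → E →ᵃ[ℝ] ℝ) (vtx : ι → E) (cen : E),
      (∀ i ∈ T, ∃ c : ℝ, c ≠ 0 ∧ ∀ w, lam i w = c * f i w) ∧
      (∀ i ∈ T, lam i (vtx i) = 1) ∧
      (∀ i ∈ T, ∀ j ∈ T, j ≠ i → f j (vtx i) = 0) ∧
      (∀ i ∈ T, lam i cen = 1 / 3) ∧
      (∀ w, ∑ i ∈ T, lam i w = 1) ∧
      (∀ l w, f l w = ∑ i ∈ T, lam i w * f l (vtx i)) := by
  classical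
  obtain ⟨i, j, k, hij, hik, hjk, rfl⟩ := Finset.card_eq_three.1 hT
  obtain ⟨a, haj, hak⟩ := h1 j k hjk
  obtain ⟨b, hbi, hbk⟩ := h1 i k hik
  obtain ⟨c, hci, hcj⟩ := h1 i j hij
  have hai := h2 j k i a hjk hij.symm hik.symm haj hak
  have hbj := h2 i k j b hik hij hjk.symm hbi hbk
  have hck := h2 i j k c hij hik hjk hci hcj
  have hw : ∀ w, w = c + (f i w / f i a) • (a - c) + (f j w / f j b) • (b - c) := by
    intro w
    refine h3 i j _ _ hij ?_ ?_
    · rw [AffineMap.apply_triangle, hci, hbi]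
      field_simp
      ring
    · rw [AffineMap.apply_triangle, hcj, haj]
      field_simp
      ring
  have hsum : ∀ w, f k w / f k c = 1 - f i w / f i a - f j w / f j b := by
    intro w
    rw [div_eq_iff hck]
    conv_lhs => rw [hw w, AffineMap.apply_triangle, hak, hbk]
    ring
  let vtx : ι → E := fun x => if x = i then a else if x = j then b else c
  have vi : vtx i = a := by simp [vtx]
  have vj : vtx j = b := by simp [vtx, hij.symm]
  have vk : vtx k = c := by simp [vtx, hik.symm, hjk.symm]
  have hS : ∀ F : ι → ℝ, ∑ x ∈ ({i, j, k} : Finset ι), F x = F i + F j + F k := by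
    intro F
    rw [Finset.sum_insert (by simp [hij, hik]), Finset.sum_pair hjk, add_assoc]
  have hA : ∀ P : ι → Prop, P i → P j → P k → ∀ x ∈ ({i, j, k} : Finset ι), P x := by
    intro P pi pj pk x hx
    simp only [Finset.mem_insert, Finset.mem_singleton] at hx
    rcases hx with rfl | rfl | rfl <;> assumption
  have hlam : ∀ x w, ((f x (vtx x))⁻¹ • f x) w = f x w / f x (vtx x) := by
    intro x w
    simp [div_eq_inv_mul]
  refine ⟨fun x => (f x (vtx x))⁻¹ • f x, vtx,
    c + (1 / 3 : ℝ) • (a - c) + (1 / 3 : ℝ) • (b - c), ?_, ?_, ?_, ?_, ?_, ?_⟩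
  · refine hA _ ?_ ?_ ?_
    · exact ⟨_, inv_ne_zero (vi ▸ hai), fun w => by simp⟩
    · exact ⟨_, inv_ne_zero (vj ▸ hbj), fun w => by simp⟩
    · exact ⟨_, inv_ne_zero (vk ▸ hck), fun w => by simp⟩
  · simp only [hlam]
    refine hA _ ?_ ?_ ?_
    · rw [vi, div_self hai]
    · rw [vj, div_self hbj]
    · rw [vk, div_self hck]
  · refine hA _ (hA _ ?_ ?_ ?_) (hA _ ?_ ?_ ?_) (hA _ ?_ ?_ ?_)
    all_goals simp only [vi, vj, vk, haj, hak, hbi, hbk, hci, hcj, ne_eq, not_true_eq_false,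
      false_implies, implies_true]
  · simp only [hlam]
    refine hA _ ?_ ?_ ?_
    · rw [vi, AffineMap.apply_triangle, hci, hbi]
      field_simp
      ring
    · rw [vj, AffineMap.apply_triangle, hcj, haj]
      field_simp
      ring
    · rw [vk, AffineMap.apply_triangle, hak, hbk]
      field_simp
      ring
  · intro w
    simp only [hlam]
    rw [hS, vi, vj, vk, hsum]
    ring
  · intro l w
    simp only [hlam]
    rw [hS, vi, vj, vk, hsum]
    conv_lhs => rw [hw w, AffineMap.apply_triangle]
    ring

/-- Lines in general position, with triples `tri` of lines such that no further line separates
the vertices of the triangle formed by the triple, form a triangle system. -/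
lemma exists_triangleSystem {ι E : Type*} [NormedAddCommGroup E] [NormedSpace ℝ E]
    (f : ι → E →ᵃ[ℝ] ℝ)
    (h1 : ∀ i j, i ≠ j → ∃ q, f i q = 0 ∧ f j q = 0)
    (h2 : ∀ i j k w, i ≠ j → i ≠ k → j ≠ k → f i w = 0 → f j w = 0 → f k w ≠ 0)
    (h3 : ∀ i j w w', i ≠ j → f i w = f i w' → f j w = f j w' → w = w')
    (tri : Finset (Finset ι)) (h4 : ∀ T ∈ tri, #T = 3)
    (h5 : ∀ T ∈ tri, ∀ l ∉ T, ∀ i ∈ T, ∀ j ∈ T, ∀ v v', (∀ a ∈ T, a ≠ i → f a v = 0) →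
      (∀ a ∈ T, a ≠ j → f a v' = 0) → 0 < f l v * f l v') :
    ∃ S : TriangleSystem ι E, S.tri = tri := by
  have hb := fun T : tri => exists_barycentric f h1 h2 h3 T.1 (h4 T.1 T.2)
  choose lam vtx cen hl hself hvtx hcen hsum hf using hb
  classical
  have hpos : ∀ T : tri, ∀ l ∉ T.1, ∀ w, (∀ i ∈ T.1, 0 ≤ lam T i w) → ∀ j ∈ T.1,
      0 < f l w * f l (vtx T j) := by
    intro T l hlT w hw j hj
    rw [hf T l w, Finset.sum_mul]
    have hterm : ∀ i ∈ T.1, 0 < f l (vtx T i) * f l (vtx T j) := fun i hi =>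
      h5 T.1 T.2 l hlT i hi j hj _ _ (hvtx T i hi) (hvtx T j hj)
    refine Finset.sum_pos' (fun i hi => ?_) ?_
    · rw [mul_assoc]
      exact mul_nonneg (hw i hi) (hterm i hi).le
    · obtain ⟨i, hi, hi'⟩ : ∃ i ∈ T.1, 0 < lam T i w := by
        by_contra! h
        have := Finset.sum_nonpos h
        rw [hsum T w] at this
        linarith
      refine ⟨i, hi, ?_⟩
      rw [mul_assoc]
      exact mul_pos hi' (hterm i hi)
  refine ⟨
    { f := f
      tri := tri
      lam := fun T => if h : T ∈ tri then lam ⟨T, h⟩ else 0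
      vtx := fun T => if h : T ∈ tri then vtx ⟨T, h⟩ else 0
      cen := fun T => if h : T ∈ tri then cen ⟨T, h⟩ else 0
      exists_common := h1
      ne_zero_of_common := h2
      eq_of_eq := h3
      card_tri := h4
      lam_eq := fun T hT => by
        simp only [hT, dif_pos]
        exact hl ⟨T, hT⟩
      lam_vtx_self := fun T hT => by
        simp only [hT, dif_pos]
        exact hself ⟨T, hT⟩
      lam_vtx := fun T hT i hi j hj hji => by
        simp only [hT, dif_pos]
        obtain ⟨c, -, hc⟩ := hl ⟨T, hT⟩ j hj
        rw [hc, hvtx ⟨T, hT⟩ i hi j hj hji, mul_zero]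
      lam_cen := fun T hT => by
        simp only [hT, dif_pos]
        exact hcen ⟨T, hT⟩
      sum_lam := fun T hT => by
        simp only [hT, dif_pos]
        exact hsum ⟨T, hT⟩
      sep := fun T hT l hlT w w' => by
        simp only [hT, dif_pos]
        intro hw hw'
        obtain ⟨j, hj⟩ : T.Nonempty := Finset.card_pos.1 (by rw [h4 T hT]; norm_num)
        have p := hpos ⟨T, hT⟩ l hlT w hw j hj
        have p' := hpos ⟨T, hT⟩ l hlT w' hw' j hj
        have := mul_pos p p'
        have h0 : 0 < f l (vtx ⟨T, hT⟩ j) ^ 2 := by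
          have := right_ne_zero_of_mul p.ne'
          positivity
        refine pos_of_mul_pos_left (b := f l (vtx ⟨T, hT⟩ j) ^ 2) ?_ h0.le
        linarith }, rfl⟩

/-- The line with equation `x sin θ + y cos θ = sin 3θ`. -/
noncomputable def chord (θ : ℝ) : (Fin 2 → ℝ) →ᵃ[ℝ] ℝ :=
  (Real.sin θ • LinearMap.proj 0 + Real.cos θ • LinearMap.proj 1 :
    (Fin 2 → ℝ) →ₗ[ℝ] ℝ).toAffineMap + AffineMap.const ℝ _ (-Real.sin (3 * θ))

lemma chord_apply (θ : ℝ) (w : Fin 2 → ℝ) :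
    chord θ w = w 0 * Real.sin θ + w 1 * Real.cos θ - Real.sin (3 * θ) := by
  simp [chord]
  ring

lemma chord_identity (a b c : ℝ) (w : Fin 2 → ℝ) :
    chord a w * Real.sin (b - c) + chord b w * Real.sin (c - a) + chord c w * Real.sin (a - b) =
      -4 * Real.sin (a + b + c) * Real.sin (a - b) * Real.sin (b - c) * Real.sin (c - a) := by
  simp only [chord_apply, Real.sin_sub, Real.sin_add, Real.cos_add, Real.sin_three_mul]
  have ha := Real.sin_sq_add_cos_sq a
  have hb := Real.sin_sq_add_cos_sq b
  have hc := Real.sin_sq_add_cos_sq c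
  generalize Real.sin a = s at *
  generalize Real.cos a = s' at *
  generalize Real.sin b = t at *
  generalize Real.cos b = t' at *
  generalize Real.sin c = u at *
  generalize Real.cos c = u' at *
  have e1 : 3 * s - 4 * s ^ 3 =
      (3 * s * s' ^ 2 - s ^ 3) * (t ^ 2 + t' ^ 2) * (u ^ 2 + u' ^ 2) := by
    rw [hb, hc]; linear_combination (-3 * s) * ha
  have e2 : 3 * t - 4 * t ^ 3 =
      (3 * t * t' ^ 2 - t ^ 3) * (s ^ 2 + s' ^ 2) * (u ^ 2 + u' ^ 2) := by
    rw [ha, hc]; linear_combination (-3 * t) * hb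
  have e3 : 3 * u - 4 * u ^ 3 =
      (3 * u * u' ^ 2 - u ^ 3) * (s ^ 2 + s' ^ 2) * (t ^ 2 + t' ^ 2) := by
    rw [ha, hb]; linear_combination (-3 * u) * hc
  rw [e1, e2, e3]
  ring

lemma chord_of_common {a b : ℝ} (c : ℝ) (hab : Real.sin (a - b) ≠ 0) {w : Fin 2 → ℝ}
    (ha : chord a w = 0) (hb : chord b w = 0) :
    chord c w = 4 * (Real.sin (c - a) * Real.sin (c - b) * Real.sin (c + a + b)) := by
  have h := chord_identity a b c w
  rw [ha, hb, zero_mul, zero_mul, zero_add, zero_add] at h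
  refine mul_right_cancel₀ hab ?_
  rw [h, ← neg_sub c b, Real.sin_neg, show a + b + c = c + a + b by ring]
  ring

lemma chord_exists_common {a b : ℝ} (hab : Real.sin (a - b) ≠ 0) :
    ∃ w, chord a w = 0 ∧ chord b w = 0 := by
  refine ⟨![(Real.sin (3 * a) * Real.cos b - Real.sin (3 * b) * Real.cos a) / Real.sin (a - b),
    (Real.sin a * Real.sin (3 * b) - Real.sin b * Real.sin (3 * a)) / Real.sin (a - b)], ?_, ?_⟩
  all_goals
    simp only [chord_apply, Matrix.cons_val_zero, Matrix.cons_val_one]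
    field_simp
    rw [Real.sin_sub]
    ring

lemma chord_eq_of_eq {a b : ℝ} (hab : Real.sin (a - b) ≠ 0) {w w' : Fin 2 → ℝ}
    (ha : chord a w = chord a w') (hb : chord b w = chord b w') : w = w' := by
  simp only [chord_apply] at ha hb
  rw [Real.sin_sub] at hab
  ext i
  fin_cases i
  · refine mul_right_cancel₀ hab ?_
    simp only [Fin.zero_eta]
    linear_combination Real.cos b * ha - Real.cos a * hb
  · refine mul_right_cancel₀ hab ?_
    simp only [Fin.mk_one]
    linear_combination Real.sin a * hb - Real.sin b * ha
lemma sin_mul_pi_div_ne_zero {m : ℕ} (hm : 0 < m) {x : ℝ} (hx : ∀ N : ℤ, x ≠ N * m) :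
    Real.sin (x * Real.pi / m) ≠ 0 := by
  rw [Ne, Real.sin_eq_zero_iff]
  rintro ⟨N, hN⟩
  have hm' : (m : ℝ) ≠ 0 := by positivity
  rw [eq_div_iff hm'] at hN
  refine hx N (mul_right_cancel₀ Real.pi_ne_zero ?_)
  linarith

lemma sin_mul_sin_half_pos {m : ℕ} {a : ℤ} (h0 : a ≠ 0) (h1 : |a| < m) {δ : ℝ}
    (hδ : |δ| = 1 / 2) :
    0 < Real.sin (a * Real.pi / m) * Real.sin ((a + δ) * Real.pi / m) := by
  have hm : (0 : ℝ) < m := by exact_mod_cast (abs_nonneg a).trans_lt h1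
  have hpi := Real.pi_pos
  have key : ∀ x : ℝ, 0 < x → x < m → 0 < Real.sin (x * Real.pi / m) := by
    intro x hx hxm
    refine Real.sin_pos_of_pos_of_lt_pi (by positivity) ?_
    rw [div_lt_iff₀ hm, mul_comm]
    exact mul_lt_mul_of_pos_left hxm hpi
  obtain ⟨hδ1, hδ2⟩ := abs_le.1 hδ.le
  rcases lt_or_gt_of_ne h0 with ha | ha
  · have e1 : (a : ℝ) ≤ -1 := by exact_mod_cast Int.le_sub_one_of_lt ha
    have e2 : -(a : ℝ) + 1 ≤ m := by
      rw [abs_of_neg ha] at h1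
      exact_mod_cast h1
    have p1 := key (-a) (by linarith) (by linarith)
    have p2 := key (-(a + δ)) (by linarith) (by linarith)
    rw [neg_mul, neg_div, Real.sin_neg] at p1 p2
    nlinarith
  · have e1 : (1 : ℝ) ≤ a := by exact_mod_cast ha
    have e2 : (a : ℝ) + 1 ≤ m := by
      rw [abs_of_pos ha] at h1
      exact_mod_cast h1
    exact mul_pos (key a (by linarith) (by linarith)) (key (a + δ) (by linarith) (by linarith))

/-- The angle parametrizing the line with index `i`. -/
noncomputable def angle (m : ℕ) (i : ZMod m) : ℝ := ((i.val : ℝ) + 1 / 6) * Real.pi / m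

lemma angle_sub {m : ℕ} (i j : ZMod m) :
    angle m i - angle m j = (((i.val : ℤ) - j.val : ℤ) : ℝ) * Real.pi / m := by
  push_cast
  rw [angle, angle]
  ring

section

variable {m : ℕ} [NeZero m]

lemma val_sub_val_ne_zero {i j : ZMod m} (h : i ≠ j) : (i.val : ℤ) - j.val ≠ 0 := by
  intro h'
  exact h (ZMod.val_injective m (by omega))

lemma abs_val_sub_val_lt (i j : ZMod m) : |(i.val : ℤ) - j.val| < m := by
  have := ZMod.val_lt i
  have := ZMod.val_lt j
  rw [abs_lt]
  omega

lemma sin_angle_sub_ne_zero {i j : ZMod m} (h : i ≠ j) :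
    Real.sin (angle m i - angle m j) ≠ 0 := by
  rw [angle_sub]
  exact left_ne_zero_of_mul
    (sin_mul_sin_half_pos (δ := 1 / 2) (val_sub_val_ne_zero h) (abs_val_sub_val_lt i j)
      (by norm_num)).ne'

lemma sin_angle_add_ne_zero (i j k : ZMod m) :
    Real.sin (angle m i + angle m j + angle m k) ≠ 0 := by
  have : angle m i + angle m j + angle m k =
      ((i.val : ℝ) + j.val + k.val + 1 / 2) * Real.pi / m := by
    simp only [angle]
    ring
  rw [this]
  refine sin_mul_pi_div_ne_zero (NeZero.pos m) fun N hN => ?_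
  have h2 : (2 * (i.val + j.val + k.val) + 1 : ℤ) = 2 * (N * m) := by
    have : (2 * (i.val + j.val + k.val) + 1 : ℝ) = 2 * (N * m) := by linarith
    exact_mod_cast this
  omega

/-- The triples of indices whose sum is `0` or `-1`. -/
def zeroSumTriples (m : ℕ) [NeZero m] : Finset (Finset (ZMod m)) :=
  {T ∈ powersetCard 3 univ | ∑ i ∈ T, i = 0 ∨ ∑ i ∈ T, i = -1}

lemma exists_shift {i j k : ZMod m} (h : i + j + k = 0 ∨ i + j + k = -1) :
    ∃ (N : ℕ) (δ : ℝ), |δ| = 1 / 2 ∧ (i.val : ℝ) + j.val + k.val + 1 / 2 = N * m + δ := by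
  rcases h with h | h
  · have : ((i.val + j.val + k.val : ℕ) : ZMod m) = 0 := by
      push_cast
      simpa using h
    obtain ⟨N, hN⟩ := (ZMod.natCast_eq_zero_iff _ _).1 this
    have hN' : (i.val : ℝ) + j.val + k.val = m * N := by exact_mod_cast hN
    exact ⟨N, 1 / 2, by norm_num, by linarith⟩
  · have : ((i.val + j.val + k.val + 1 : ℕ) : ZMod m) = 0 := by
      push_cast
      simp [h]
    obtain ⟨N, hN⟩ := (ZMod.natCast_eq_zero_iff _ _).1 this
    have hN' : (i.val : ℝ) + j.val + k.val + 1 = m * N := by exact_mod_cast hN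
    exact ⟨N, -(1 / 2), by norm_num, by linarith⟩

/-- No line meets the triangle formed by three other lines whose indices sum to `0` or `-1`. -/
lemma sin_product_pos {i j k l : ZMod m} (h : i + j + k = 0 ∨ i + j + k = -1)
    (hi : l ≠ i) (hj : l ≠ j) :
    0 < (Real.sin (angle m l - angle m j) * Real.sin (angle m l + angle m i + angle m k)) *
      (Real.sin (angle m l - angle m i) * Real.sin (angle m l + angle m j + angle m k)) := by
  obtain ⟨N, δ, hδ, hN⟩ := exists_shift h
  have hm : (m : ℝ) ≠ 0 := by exact_mod_cast NeZero.ne m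
  have e1 : angle m l + angle m i + angle m k =
      ((((l.val : ℤ) - j.val : ℤ) : ℝ) + δ) * Real.pi / m + N * Real.pi := by
    simp only [angle]
    push_cast
    field_simp
    linear_combination 6 * hN
  have e2 : angle m l + angle m j + angle m k =
      ((((l.val : ℤ) - i.val : ℤ) : ℝ) + δ) * Real.pi / m + N * Real.pi := by
    simp only [angle]
    push_cast
    field_simp
    linear_combination 6 * hN
  have p1 := sin_mul_sin_half_pos (val_sub_val_ne_zero hj) (abs_val_sub_val_lt l j) hδ
  have p2 := sin_mul_sin_half_pos (val_sub_val_ne_zero hi) (abs_val_sub_val_lt l i) hδ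
  have hs : ((-1 : ℝ) ^ N) * (-1) ^ N = 1 := by rw [← mul_pow]; simp
  rw [e1, e2, Real.sin_add_nat_mul_pi, Real.sin_add_nat_mul_pi, angle_sub, angle_sub]
  have aux : ∀ a b c d s : ℝ, s * s = 1 → a * b * (c * d) = a * (s * b) * (c * (s * d)) := by
    intro a b c d s hs
    linear_combination (-(a * b * c * d)) * hs
  exact (mul_pos p1 p2).trans_eq (aux _ _ _ _ _ hs)

lemma exists_triangleSystem_zeroSumTriples (m : ℕ) [NeZero m] :
    ∃ S : TriangleSystem (ZMod m) (Fin 2 → ℝ), S.tri = zeroSumTriples m := by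
  have hcard : ∀ T ∈ zeroSumTriples m, #T = 3 := fun T hT =>
    (Finset.mem_powersetCard.1 (Finset.mem_filter.1 hT).1).2
  refine exists_triangleSystem (fun i => chord (angle m i))
    (fun i j hij => chord_exists_common (sin_angle_sub_ne_zero hij)) ?_
    (fun i j w w' hij => chord_eq_of_eq (sin_angle_sub_ne_zero hij)) _ hcard ?_
  · intro i j k w hij hik hjk hi hj
    rw [chord_of_common _ (sin_angle_sub_ne_zero hij) hi hj]
    exact mul_ne_zero four_ne_zero (mul_ne_zero (mul_ne_zero (sin_angle_sub_ne_zero hik.symm)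
      (sin_angle_sub_ne_zero hjk.symm)) (sin_angle_add_ne_zero k i j))
  · intro T hT l hl i hi j hj v v' hv hv'
    have hsum := (Finset.mem_filter.1 hT).2
    have hne : ∀ a ∈ T, l ≠ a := fun a ha h => hl (h ▸ ha)
    by_cases hij : i = j
    · subst hij
      obtain ⟨b, c, hbc, hT'⟩ := Finset.card_eq_two.1
        (show #(T.erase i) = 2 by rw [Finset.card_erase_of_mem hi, hcard T hT])
      have hb : b ≠ i ∧ b ∈ T := Finset.mem_erase.1 (by simp [hT'])
      have hc : c ≠ i ∧ c ∈ T := Finset.mem_erase.1 (by simp [hT'])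
      obtain rfl : v = v' := chord_eq_of_eq (sin_angle_sub_ne_zero hbc)
        (by rw [hv b hb.2 hb.1, hv' b hb.2 hb.1]) (by rw [hv c hc.2 hc.1, hv' c hc.2 hc.1])
      refine mul_self_pos.2 ?_
      rw [chord_of_common _ (sin_angle_sub_ne_zero hbc) (hv b hb.2 hb.1) (hv c hc.2 hc.1)]
      exact mul_ne_zero four_ne_zero (mul_ne_zero (mul_ne_zero
        (sin_angle_sub_ne_zero (hne b hb.2)) (sin_angle_sub_ne_zero (hne c hc.2)))
        (sin_angle_add_ne_zero _ _ _))
    · obtain ⟨k, hk⟩ := Finset.card_eq_one.1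
        (show #((T.erase i).erase j) = 1 by
          rw [Finset.card_erase_of_mem (Finset.mem_erase.2 ⟨Ne.symm hij, hj⟩),
            Finset.card_erase_of_mem hi, hcard T hT])
      have hk' : k ≠ j ∧ k ≠ i ∧ k ∈ T := by
        have : k ∈ (T.erase i).erase j := by simp [hk]
        simpa using this
      obtain ⟨hkj, hki, hkT⟩ := hk'
      have hT' : T = {i, j, k} := by
        rw [← Finset.insert_erase hi,
          ← Finset.insert_erase (Finset.mem_erase.2 ⟨Ne.symm hij, hj⟩), hk]
      have hsum' : i + j + k = 0 ∨ i + j + k = -1 := by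
        rw [hT', Finset.sum_insert (by simp [hij, hki.symm]), Finset.sum_pair hkj.symm,
          ← add_assoc] at hsum
        exact hsum
      have hpos := sin_product_pos hsum' (hne i hi) (hne j hj)
      have hlk := sin_angle_sub_ne_zero (hne k hkT)
      rw [chord_of_common _ (sin_angle_sub_ne_zero hkj.symm) (hv j hj (Ne.symm hij))
        (hv k hkT hki), chord_of_common _ (sin_angle_sub_ne_zero hki.symm) (hv' i hi hij)
        (hv' k hkT hkj)]
      have hsq : 0 < 16 * Real.sin (angle m l - angle m k) ^ 2 := by positivity
      refine (mul_pos hsq hpos).trans_eq ?_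
      ring

lemma card_triples_sum_eq (c : ZMod m) :
    m ^ 2 ≤ 6 * #{T ∈ powersetCard 3 (univ : Finset (ZMod m)) | ∑ i ∈ T, i = c} + 3 * m := by
  have hm : #(univ : Finset (ZMod m)) = m := by rw [Finset.card_univ, ZMod.card]
  let bad : Finset (ZMod m × ZMod m) :=
    (univ.image fun i => (i, i)) ∪ (univ.image fun i => (i, c - i - i)) ∪
      univ.image fun i => (c - i - i, i)
  have hbad : #bad ≤ 3 * m := by
    have h1 := Finset.card_image_le (s := univ) (f := fun i : ZMod m => (i, i))
    have h2 := Finset.card_image_le (s := univ) (f := fun i : ZMod m => (i, c - i - i))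
    have h3 := Finset.card_image_le (s := univ) (f := fun i : ZMod m => (c - i - i, i))
    have h4 := Finset.card_union_le
      ((univ.image fun i : ZMod m => (i, i)) ∪ (univ.image fun i => (i, c - i - i)))
      (univ.image fun i => (c - i - i, i))
    have h5 := Finset.card_union_le
      (univ.image fun i : ZMod m => (i, i)) (univ.image fun i => (i, c - i - i))
    rw [hm] at h1 h2 h3
    refine h4.trans ?_
    omega
  have hgood : ∀ p ∉ bad, p.1 ≠ p.2 ∧ p.1 ≠ c - p.1 - p.2 ∧ p.2 ≠ c - p.1 - p.2 := by
    rintro ⟨i, j⟩ hp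
    simp only [bad, Finset.mem_union, Finset.mem_image, Finset.mem_univ, true_and, not_or,
      not_exists, Prod.mk.injEq, not_and] at hp
    obtain ⟨⟨h1, h2⟩, h3⟩ := hp
    refine ⟨h1 i rfl, fun h => h2 i rfl ?_, fun h => h3 j ?_ rfl⟩
    · simp only at h
      linear_combination -h
    · simp only at h
      linear_combination -h
  have hmap : #badᶜ ≤
      6 * #{T ∈ powersetCard 3 (univ : Finset (ZMod m)) | ∑ i ∈ T, i = c} := by
    refine Finset.card_le_mul_card_image_of_maps_to
      (f := fun p : ZMod m × ZMod m => ({p.1, p.2, c - p.1 - p.2} : Finset (ZMod m))) ?_ 6 ?_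
    · intro p hp
      obtain ⟨h1, h2, h3⟩ := hgood p (Finset.mem_compl.1 hp)
      simp only [Finset.mem_filter, Finset.mem_powersetCard_univ]
      refine ⟨Finset.card_eq_three.2 ⟨_, _, _, h1, h2, h3, rfl⟩, ?_⟩
      rw [Finset.sum_insert (by simp [h1, h2]), Finset.sum_pair h3]
      ring
    · intro T hT
      have hT3 : #T = 3 := Finset.mem_powersetCard_univ.1 (Finset.mem_filter.1 hT).1
      have h6 : #T.offDiag = 6 := by rw [Finset.offDiag_card, hT3]
      rw [← h6]
      refine Finset.card_le_card fun p hp => ?_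
      obtain ⟨hpb, rfl⟩ := Finset.mem_filter.1 hp
      have h1 := (hgood p (Finset.mem_compl.1 hpb)).1
      simp [h1]
  rw [Finset.card_compl, Fintype.card_prod, ZMod.card] at hmap
  rw [sq]
  omega

lemma card_zeroSumTriples (hm : 2 ≤ m) : m ^ 2 ≤ 3 * #(zeroSumTriples m) + 3 * m := by
  have : Fact (1 < m) := ⟨hm⟩
  have h0 := card_triples_sum_eq (m := m) 0
  have h1 := card_triples_sum_eq (m := m) (-1)
  rw [zeroSumTriples, Finset.filter_or, Finset.card_union_of_disjoint]
  · omega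
  · refine Finset.disjoint_filter.2 fun T _ h h' => ?_
    rw [h] at h'
    simp at h'

end

end

/-- **Construction of Kalai and Patáková.**
For every `n ≥ 6` there are `n` pairwise distinct subsets `F₁, …, F_n` of `ℝ²` such that
(i) the intersection of every nonempty subfamily is empty or path-connected, (ii) every
subfamily with at least `4` members has empty intersection, and (iii) at least
`C(n−1, 2) + (n² − 6n + 3)/3` of the `3`-element index sets have intersecting members. -/
theorem kalai_patakova_construction
    (n : ℕ) (hn : 6 ≤ n) :
    ∃ F : Fin n → Set (Fin 2 → ℝ),
      Function.Injective F ∧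
      (∀ I : Finset (Fin n), I.Nonempty →
        (⋂ i ∈ I, F i) = ∅ ∨ IsPathConnected (⋂ i ∈ I, F i)) ∧
      (∀ I : Finset (Fin n), 4 ≤ I.card → (⋂ i ∈ I, F i) = ∅) ∧
      ((((n - 1).choose 2 : ℝ) + ((n : ℝ) ^ 2 - 6 * (n : ℝ) + 3) / 3) ≤
        ({I : Finset (Fin n) | I.card = 3 ∧ (⋂ i ∈ I, F i).Nonempty}.ncard : ℝ)) := by
  obtain ⟨m, rfl⟩ : ∃ m, n = m + 1 := ⟨n - 1, by omega⟩
  have : NeZero m := ⟨by omega⟩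
  have : Fact (1 < m) := ⟨by omega⟩
  obtain ⟨S, hS⟩ := exists_triangleSystem_zeroSumTriples m
  have e : Fin (m + 1) ≃ Option (ZMod m) := Fintype.equivOfCardEq (by simp [ZMod.card])
  have hF : ∀ I : Finset (Fin (m + 1)),
      (⋂ i ∈ I, S.family (e i)) = ⋂ a ∈ I.map e.toEmbedding, S.family a := by
    intro I
    rw [Finset.map_eq_image, Finset.set_biInter_finset_image]
    rfl
  refine ⟨fun i => S.family (e i), ?_, ?_, ?_, ?_⟩
  · exact (TriangleSystem.family_injective (by rw [ZMod.card]; omega)).comp e.injective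
  · intro I hI
    rw [hF]
    exact TriangleSystem.iInter_family_isPathConnected (by simp) (by simpa using hI)
  · intro I hI
    rw [hF]
    exact TriangleSystem.iInter_family_eq_empty (by simpa using hI)
  · have hcount := TriangleSystem.choose_add_card_le (S := S)
    rw [ZMod.card, hS] at hcount
    have hcard := card_zeroSumTriples (m := m) (by omega)
    have hle : {I : Finset (Option (ZMod m)) | I.card = 3 ∧ (⋂ a ∈ I, S.family a).Nonempty}.ncard ≤
        {I : Finset (Fin (m + 1)) | I.card = 3 ∧ (⋂ i ∈ I, S.family (e i)).Nonempty}.ncard := by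
      refine Set.ncard_le_ncard_of_injOn (fun I => I.map e.symm.toEmbedding) ?_
        (Finset.map_injective _).injOn (Set.toFinite _)
      rintro I ⟨hI, hne⟩
      refine ⟨by rw [Finset.card_map, hI], ?_⟩
      rw [hF, Finset.map_map]
      simpa using hne
    have h1 : ((m.choose 2 : ℕ) : ℝ) + (zeroSumTriples m).card ≤
        ({I : Finset (Fin (m + 1)) |
          I.card = 3 ∧ (⋂ i ∈ I, S.family (e i)).Nonempty}.ncard : ℝ) := by
      exact_mod_cast hcount.trans hle
    have h2 : (m : ℝ) ^ 2 ≤ 3 * (zeroSumTriples m).card + 3 * m := by exact_mod_cast hcard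
    refine le_trans ?_ h1
    rw [Nat.add_sub_cancel]
    push_cast
    have hm0 : (0 : ℝ) ≤ m := Nat.cast_nonneg m
    nlinarith
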